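/- arXiv:2312.03149 — 2 statements merged into one kernel-verified Lean document; each statement's English description precedes it below -/
import Mathlib

section
/- For every integer n ≥ 9 that is not prime, there exists a nut graph G of order n whose automorphism group has exactly two orbits on the vertex set, i.e., o_v(G) = 2. -/
namespace NutPaper

open Matrix

variable {V : Type*}

open scoped Classical in
/-- The real adjacency matrix of a simple graph. -/
noncomputable def adjMat (G : SimpleGraph V) : Matrix V V ℝ :=
  Matrix.of fun u v => if G.Adj u v then (1 : ℝ) else 0

/-- A nut graph: the adjacency matrix has nullity exactly one, and every
nonzero kernel vector has all entries nonzero. -/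
def IsNutGraph [Fintype V] (G : SimpleGraph V) : Prop :=
  Module.finrank ℝ (LinearMap.ker (Matrix.mulVecLin (adjMat G))) = 1 ∧
  ∀ x : V → ℝ, adjMat G *ᵥ x = 0 → x ≠ 0 → ∀ v, x v ≠ 0

/-- The orbit of a vertex under the full automorphism group. -/
def vertexOrbit (G : SimpleGraph V) (v : V) : Set V :=
  {u | ∃ α : G ≃g G, α v = u}

/-- The set of vertex orbits. -/
def vertexOrbits (G : SimpleGraph V) : Set (Set V) :=
  Set.range (vertexOrbit G)

/-- The number of vertex orbits. -/
noncomputable def numVertexOrbits (G : SimpleGraph V) : ℕ :=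
  Nat.card (vertexOrbits G)

/-- The orbit of an edge under the full automorphism group. -/
def edgeOrbit (G : SimpleGraph V) (e : Sym2 V) : Set (Sym2 V) :=
  {f | ∃ α : G ≃g G, Sym2.map (⇑α) e = f}

/-- The set of edge orbits. -/
def edgeOrbits (G : SimpleGraph V) : Set (Set (Sym2 V)) :=
  edgeOrbit G '' G.edgeSet

/-- The number of edge orbits. -/
noncomputable def numEdgeOrbits (G : SimpleGraph V) : ℕ :=
  Nat.card (edgeOrbits G)


open scoped Classical in
/-- A sum over neighbours, given by an injective enumeration of the neighbourhood. -/
lemma sum_nbrs {V K : Type*} [Fintype V] [Fintype K] (G : SimpleGraph V) (v : V) (f : K → V)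
    (hf : Function.Injective f) (h : ∀ u, G.Adj v u ↔ ∃ k, f k = u) (x : V → ℝ) :
    ∑ u, (if G.Adj v u then x u else 0) = ∑ k, x (f k) := by
  rw [← Finset.sum_filter, ← Finset.sum_image (f := x) (s := Finset.univ) (g := f)
    (fun a _ b _ hab => hf hab)]
  apply Finset.sum_congr _ (fun _ _ => rfl)
  ext u
  simp [h]

open scoped Classical in
/-- A criterion for being a nut graph with two vertex orbits. -/
lemma criterion {V : Type*} [Fintype V] (G : SimpleGraph V) (x₀ : V → ℝ)
    (h0 : ∀ v, x₀ v ≠ 0)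
    (hk : ∀ x : V → ℝ, (∀ v, ∑ u, (if G.Adj v u then x u else 0) = 0) ↔ ∃ c : ℝ, x = c • x₀)
    (P : V → Prop) (hinv : ∀ (α : G ≃g G) v, P v → P (α v))
    (htr : ∀ v w, (P v ↔ P w) → ∃ α : G ≃g G, α v = w)
    (a b : V) (ha : P a) (hb : ¬ P b) :
    IsNutGraph G ∧ numVertexOrbits G = 2 := by
  have key : ∀ x : V → ℝ, adjMat G *ᵥ x = 0 ↔ ∃ c : ℝ, x = c • x₀ := by
    intro x
    rw [← hk x, funext_iff]
    apply forall_congr'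
    intro v
    simp [Matrix.mulVec, dotProduct, adjMat]
  refine ⟨⟨?_, ?_⟩, ?_⟩
  · have : LinearMap.ker (Matrix.mulVecLin (adjMat G)) = Submodule.span ℝ {x₀} := by
      ext x
      rw [LinearMap.mem_ker, Matrix.mulVecLin_apply, key, Submodule.mem_span_singleton]
      simp only [eq_comm]
    rw [this]
    apply finrank_span_singleton
    intro h
    exact h0 a (by rw [h]; rfl)
  · intro x hx hx0 v hv
    obtain ⟨c, rfl⟩ := (key x).1 hx
    simp only [Pi.smul_apply, smul_eq_mul, mul_eq_zero, h0, or_false] at hv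
    exact hx0 (by rw [hv, zero_smul])
  · have horb : ∀ v, vertexOrbit G v = {u | P v ↔ P u} := by
      intro v
      ext u
      simp only [vertexOrbit, Set.mem_ofPred_eq]
      constructor
      · rintro ⟨α, rfl⟩
        refine ⟨hinv α v, fun h => ?_⟩
        have := hinv α.symm _ h
        simpa using this
      · exact htr v u
    have : vertexOrbits G = {vertexOrbit G a, vertexOrbit G b} := by
      ext s
      simp only [vertexOrbits, Set.mem_range, Set.mem_insert_iff, Set.mem_singleton_iff]
      constructor
      · rintro ⟨v, rfl⟩
        by_cases hv : P v
        · left; rw [horb, horb]; simp [hv, ha]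
        · right; rw [horb, horb]; simp [hv, hb]
      · rintro (rfl | rfl)
        · exact ⟨a, rfl⟩
        · exact ⟨b, rfl⟩
    rw [numVertexOrbits, this, Nat.card_coe_set_eq, Set.ncard_pair]
    intro h
    have h1 : a ∈ vertexOrbit G b := by
      rw [← h, horb]; exact Iff.rfl
    rw [horb] at h1
    exact hb (h1.2 ha)

open scoped Classical in
/-- The criterion transported to `Fin n`. -/
lemma criterion_fin {V : Type*} [Fintype V] {n : ℕ} (hn : Fintype.card V = n)
    (G : SimpleGraph V) (x₀ : V → ℝ)
    (h0 : ∀ v, x₀ v ≠ 0)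
    (hk : ∀ x : V → ℝ, (∀ v, ∑ u, (if G.Adj v u then x u else 0) = 0) ↔ ∃ c : ℝ, x = c • x₀)
    (P : V → Prop) (hinv : ∀ (α : G ≃g G) v, P v → P (α v))
    (htr : ∀ v w, (P v ↔ P w) → ∃ α : G ≃g G, α v = w)
    (a b : V) (ha : P a) (hb : ¬ P b) :
    ∃ G : SimpleGraph (Fin n), IsNutGraph G ∧ numVertexOrbits G = 2 := by
  obtain e : Fin n ≃ V := (Fintype.equivFinOfCardEq hn).symm
  let φ : G.comap e ≃g G := ⟨e, Iff.rfl⟩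
  refine ⟨G.comap e, criterion (G.comap e) (x₀ ∘ e) (fun v => h0 _) ?_ (P ∘ e) ?_ ?_
    (e.symm a) (e.symm b) (by simpa using ha) (by simpa using hb)⟩
  · intro x
    have h1 := hk (x ∘ e.symm)
    refine (Iff.trans ?_ h1).trans ?_
    · rw [← e.forall_congr_right]
      apply forall_congr'
      intro v
      rw [← e.sum_comp]
      simp
    apply exists_congr
    intro c
    constructor
    · intro h
      ext v
      have := congrFun h (e v)
      simpa using this
    · intro h
      ext v
      rw [h]
      simp
  · intro α v hv
    have := hinv ((φ.symm.trans α).trans φ) (e v) hv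
    have h2 : ((φ.symm.trans α).trans φ) (e v) = e (α v) := by
      change e (α (e.symm (e v))) = _
      simp
    rw [h2] at this
    exact this
  · intro v w h
    obtain ⟨α, hα⟩ := htr (e v) (e w) h
    refine ⟨(φ.trans α).trans φ.symm, ?_⟩
    change e.symm (α (e v)) = w
    rw [hα]; simp

/-- A subset of `ZMod m` closed under adding a unit is everything. -/
lemma all_of_step {m : ℕ} [NeZero m] (u : ZMod m) (hu : IsUnit u) (S : ZMod m → Prop)
    (i : ZMod m) (hi : S i) (hs : ∀ j, S j → S (j + u)) (j : ZMod m) : S j := by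
  have h : ∀ k : ℕ, S (i + k * u) := by
    intro k
    induction k with
    | zero => simpa using hi
    | succ k ih =>
      have := hs _ ih
      convert this using 1
      push_cast; ring
  obtain ⟨w, hw⟩ := hu.exists_left_inv
  have := h ((j - i) * w).val
  rw [ZMod.natCast_zmod_val, mul_assoc, hw] at this
  simpa using this

/-- Discrete harmonic functions on a cycle are constant. -/
lemma const_of_second_diff {m : ℕ} [NeZero m] (u : ZMod m) (hu : IsUnit u) (f : ZMod m → ℝ)
    (h : ∀ i, f (i + u) + f (i - u) = 2 * f i) (i j : ZMod m) : f i = f j := by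
  obtain ⟨M, hM⟩ := Finite.exists_max f
  have : ∀ j, f j = f M := by
    apply all_of_step u hu (fun j => f j = f M) M rfl
    intro j hj
    have h1 := h j
    have h2 := hM (j + u)
    have h3 := hM (j - u)
    linarith
  rw [this i, this j]

section Even

variable {m : ℕ}

/-- Neighbours in the bicirculant graph. -/
def nb (v : ZMod m × Bool) : Fin 4 → ZMod m × Bool :=
  if v.2 then ![(v.1 + 1, true), (v.1 - 1, true), (v.1, false), (v.1 + 1, false)]
  else ![(v.1 + 2, false), (v.1 - 2, false), (v.1, true), (v.1 - 1, true)]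

/-- The bicirculant graph used for even orders. -/
def bic (m : ℕ) (h1 : (1 : ZMod m) ≠ 0) (h2 : (2 : ZMod m) ≠ 0) : SimpleGraph (ZMod m × Bool) where
  Adj v u := ∃ k, nb v k = u
  symm := by
    constructor
    rintro ⟨i, b⟩ ⟨j, c⟩ ⟨k, hk⟩
    cases b <;> fin_cases k <;> simp [nb] at hk <;> obtain ⟨rfl, rfl⟩ := hk <;>
      simp [nb, Fin.exists_fin_succ]
  loopless := by
    constructor
    rintro ⟨i, b⟩ ⟨k, hk⟩
    cases b <;> fin_cases k <;> simp [nb, h1, h2] at hk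

open scoped Classical in
lemma even_case (hm : 5 ≤ m) (h3 : ¬ 3 ∣ m) :
    ∃ G : SimpleGraph (Fin (m * 2)), IsNutGraph G ∧ numVertexOrbits G = 2 := by
  have : NeZero m := ⟨by omega⟩
  have hne : ∀ k : ℕ, 0 < k → k < m → ((k : ℕ) : ZMod m) ≠ 0 := by
    intro k hk hkm h
    rw [ZMod.natCast_eq_zero_iff] at h
    exact absurd (Nat.le_of_dvd hk h) (by omega)
  have h1 : (1 : ZMod m) ≠ 0 := by simpa using hne 1 (by omega) (by omega)
  have h2 : (2 : ZMod m) ≠ 0 := by simpa using hne 2 (by omega) (by omega)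
  have h3' : (3 : ZMod m) ≠ 0 := by simpa using hne 3 (by omega) (by omega)
  have h4 : (4 : ZMod m) ≠ 0 := by simpa using hne 4 (by omega) (by omega)
  have hu : IsUnit (3 : ZMod m) := by
    have := (ZMod.isUnit_iff_coprime 3 m).2 ((Nat.Prime.coprime_iff_not_dvd Nat.prime_three).2 h3)
    simpa using this
  have h6 : (6 : ZMod m) ≠ 0 := by
    intro h
    apply h2
    have : (3 : ZMod m) * 2 = 3 * 0 := by rw [mul_zero, ← h]; norm_num
    exact hu.mul_left_cancel this
  have hsum : ∀ (x : ZMod m × Bool → ℝ) v,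
      ∑ u, (if (bic m h1 h2).Adj v u then x u else 0) = ∑ k, x (nb v k) := by
    intro x v
    apply sum_nbrs _ _ _ _ (fun u => Iff.rfl)
    rintro k l hkl
    obtain ⟨i, b⟩ := v
    cases b <;> fin_cases k <;> fin_cases l <;> simp [nb] at hkl ⊢ <;>
      (first
        | contradiction
        | exact h1 (by linear_combination hkl)
        | exact h1 (by linear_combination -hkl)
        | exact h2 (by linear_combination hkl)
        | exact h2 (by linear_combination -hkl)
        | exact h3' (by linear_combination hkl)
        | exact h3' (by linear_combination -hkl)
        | exact h4 (by linear_combination hkl)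
        | exact h4 (by linear_combination -hkl))
  refine criterion_fin (by simp [ZMod.card]) (bic m h1 h2) (fun v => if v.2 then 1 else -1) ?_ ?_
    (fun v => v.2 = true) ?_ ?_ (0, true) (0, false) rfl (by simp)
  · intro v; split_ifs <;> norm_num
  · intro x
    simp only [hsum]
    constructor
    · intro h
      have hA : ∀ i, x (i + 1, true) + x (i - 1, true) + x (i, false) + x (i + 1, false) = 0 := by
        intro i
        simpa [nb, Fin.sum_univ_four] using h (i, true)
      have hB : ∀ i, x (i + 2, false) + x (i - 2, false) + x (i, true) + x (i - 1, true) = 0 := by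
        intro i
        simpa [nb, Fin.sum_univ_four] using h (i, false)
      have cA : ∀ i j, x (i, true) = x (j, true) := by
        apply const_of_second_diff 3 hu (fun i => x (i, true))
        intro i
        have e1 := hA (i + 2)
        have e2 := hA (i - 2)
        have e3 := hB i
        have e4 := hB (i + 1)
        ring_nf at e1 e2 e3 e4 ⊢
        linarith
      have cB : ∀ i j, x (i, false) = x (j, false) := by
        apply const_of_second_diff 3 hu (fun i => x (i, false))
        intro i
        have e1 := hB (i + 1)
        have e2 := hB (i - 1)
        have e3 := hA i
        have e4 := hA (i - 1)
        ring_nf at e1 e2 e3 e4 ⊢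
        linarith
      refine ⟨x (0, true), ?_⟩
      ext ⟨i, b⟩
      have e := hA 0
      rw [cA (0 + 1) 0, cA (0 - 1) 0, cB (0 + 1) 0] at e
      cases b
      · simp [cB i 0]; linarith
      · simp [cA i 0]
    · rintro ⟨c, rfl⟩ ⟨i, b⟩
      cases b <;> simp [nb, Fin.sum_univ_four]
  · have hQ : ∀ v : ZMod m × Bool, v.2 = true ↔ ∀ u, (bic m h1 h2).Adj v u →
        ∃ w, (bic m h1 h2).Adj v w ∧ (bic m h1 h2).Adj u w := by
      rintro ⟨i, b⟩
      cases b
      · simp only [Bool.false_eq_true, false_iff]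
        intro h
        obtain ⟨w, ⟨k, rfl⟩, ⟨l, hl⟩⟩ := h (i + 2, false) ⟨0, rfl⟩
        fin_cases k <;> fin_cases l <;> simp [nb] at hl <;>
          (first
            | contradiction
            | exact h1 (by linear_combination hl)
            | exact h1 (by linear_combination -hl)
            | exact h2 (by linear_combination hl)
            | exact h2 (by linear_combination -hl)
            | exact h3' (by linear_combination hl)
            | exact h3' (by linear_combination -hl)
            | exact h4 (by linear_combination hl)
            | exact h4 (by linear_combination -hl)
            | exact h6 (by linear_combination hl))
      · simp only [true_iff]
        rintro u ⟨k, rfl⟩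
        fin_cases k
        · exact ⟨(i + 1, false), ⟨3, rfl⟩, ⟨2, rfl⟩⟩
        · exact ⟨(i, false), ⟨2, rfl⟩, ⟨3, by simp [nb]⟩⟩
        · exact ⟨(i - 1, true), ⟨1, rfl⟩, ⟨3, rfl⟩⟩
        · exact ⟨(i + 1, true), ⟨0, rfl⟩, ⟨2, rfl⟩⟩
    intro α v hv
    rw [hQ] at hv ⊢
    intro u hu
    obtain ⟨w, hw1, hw2⟩ := hv (α.symm u) (by rw [← α.map_adj_iff]; simpa using hu)
    refine ⟨α w, α.map_adj_iff.2 hw1, ?_⟩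
    have := α.map_adj_iff.2 hw2
    simpa using this
  · rintro ⟨i, b⟩ ⟨j, c⟩ h
    have hbc : b = c := by cases b <;> cases c <;> simp_all
    subst hbc
    have hs : ∀ (v : ZMod m × Bool) k, nb (v.1 + (j - i), v.2) k =
        ((nb v k).1 + (j - i), (nb v k).2) := by
      rintro ⟨v, b⟩ k
      cases b <;> fin_cases k <;> simp [nb] <;> ring
    let e : ZMod m × Bool ≃ ZMod m × Bool :=
      (Equiv.addRight (j - i)).prodCongr (Equiv.refl Bool)
    refine ⟨⟨e, ?_⟩, ?_⟩
    · intro v u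
      change (∃ k, nb (v.1 + (j - i), v.2) k = e u) ↔ ∃ k, nb v k = u
      apply exists_congr
      intro k
      rw [hs]
      exact e.injective.eq_iff (a := nb v k)
    · change (i + (j - i), b) = (j, b)
      simp

end Even

section Odd

variable {m t : ℕ}

/-- Signed step. -/
def stp (m : ℕ) (k : Fin t × Bool) : ZMod m :=
  if k.2 then ((k.1.val + 1 : ℕ) : ZMod m) else -((k.1.val + 1 : ℕ) : ZMod m)

/-- Adjacency in the triangle-multiplier of a circulant graph. -/
def tadj : ZMod m × Option (Fin t × Bool) → ZMod m × Option (Fin t × Bool) → Prop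
  | (i, none), (j, none) => ∃ k : Fin t × Bool, i + stp m k = j
  | (i, none), (j, some _) => i = j
  | (i, some _), (j, none) => i = j
  | (i, some p), (j, some q) => i = j ∧ p.1 = q.1 ∧ p.2 ≠ q.2

lemma stp_ne (hm : 2 * t + 1 ≤ m) (k : Fin t × Bool) : stp m k ≠ 0 := by
  have : ((k.1.val + 1 : ℕ) : ZMod m) ≠ 0 := by
    intro h
    rw [ZMod.natCast_eq_zero_iff] at h
    have := Nat.le_of_dvd (by omega) h
    have := k.1.2
    omega
  unfold stp
  split_ifs
  · exact this
  · exact neg_ne_zero.2 this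

lemma stp_not (k : Fin t × Bool) : stp m (k.1, !k.2) = - stp m k := by
  obtain ⟨k, b⟩ := k
  cases b <;> simp [stp]

lemma stp_inj (hm : 2 * t + 1 ≤ m) : Function.Injective (stp (t := t) m) := by
  have pos : ∀ k l : Fin t, ((k.val + 1 : ℕ) : ZMod m) = ((l.val + 1 : ℕ) : ZMod m) → k = l := by
    intro k l h
    have hk := k.2
    have hl := l.2
    rw [ZMod.natCast_eq_natCast_iff'] at h
    rw [Nat.mod_eq_of_lt (by omega), Nat.mod_eq_of_lt (by omega)] at h
    ext; omega
  have mix : ∀ k l : Fin t, ((k.val + 1 : ℕ) : ZMod m) ≠ -((l.val + 1 : ℕ) : ZMod m) := by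
    intro k l h
    have hk := k.2
    have hl := l.2
    rw [eq_neg_iff_add_eq_zero, ← Nat.cast_add, ZMod.natCast_eq_zero_iff] at h
    have := Nat.le_of_dvd (by omega) h
    omega
  rintro ⟨k, b⟩ ⟨l, c⟩ h
  cases b <;> cases c
  · simp only [stp, Bool.false_eq_true, if_false, neg_inj] at h
    rw [pos k l h]
  · simp only [stp, Bool.false_eq_true, if_false, if_true] at h
    exact absurd h.symm (mix l k)
  · simp only [stp, Bool.false_eq_true, if_false, if_true] at h
    exact absurd h (mix k l)
  · simp only [stp, if_true] at h
    rw [pos k l h]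

/-- The triangle-multiplier of a circulant graph. -/
def tri (m t : ℕ) (hm : 2 * t + 1 ≤ m) : SimpleGraph (ZMod m × Option (Fin t × Bool)) where
  Adj := tadj
  symm := by
    constructor
    rintro ⟨i, _ | p⟩ ⟨j, _ | q⟩ h
    · obtain ⟨k, rfl⟩ := h
      exact ⟨(k.1, !k.2), by rw [stp_not]; ring⟩
    · exact Eq.symm h
    · exact Eq.symm h
    · exact ⟨h.1.symm, h.2.1.symm, h.2.2.symm⟩
  loopless := by
    constructor
    rintro ⟨i, _ | p⟩ h
    · obtain ⟨k, hk⟩ := h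
      exact stp_ne hm k (by simpa using hk)
    · exact h.2.2 rfl

open scoped Classical in
lemma odd_case (ht : 1 ≤ t) (hm : 2 * t + 1 ≤ m) :
    ∃ G : SimpleGraph (Fin (m * (2 * t + 1))), IsNutGraph G ∧ numVertexOrbits G = 2 := by
  have : NeZero m := ⟨by omega⟩
  have hsN : ∀ (x : ZMod m × Option (Fin t × Bool) → ℝ) i,
      ∑ u, (if (tri m t hm).Adj (i, none) u then x u else 0) =
        ∑ k : Fin t × Bool, x (i + stp m k, none) + ∑ k, x (i, some k) := by
    intro x i
    rw [sum_nbrs (K := (Fin t × Bool) ⊕ (Fin t × Bool)) _ _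
      (Sum.elim (fun k => (i + stp m k, none)) (fun k => (i, some k)))]
    · simp
    · rintro (k | k) (l | l) h
      · simp only [Sum.elim_inl, Prod.mk.injEq, add_right_inj, and_true] at h
        rw [stp_inj hm h]
      · simp at h
      · simp at h
      · simpa using h
    · rintro ⟨j, _ | q⟩
      · simp only [tri, tadj, Sum.exists, Sum.elim_inl, Sum.elim_inr]
        simp
      · simp only [tri, tadj, Sum.exists, Sum.elim_inl, Sum.elim_inr]
        simp
  have hsS : ∀ (x : ZMod m × Option (Fin t × Bool) → ℝ) i p,
      ∑ u, (if (tri m t hm).Adj (i, some p) u then x u else 0) =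
        x (i, none) + x (i, some (p.1, !p.2)) := by
    intro x i p
    rw [sum_nbrs (K := Bool) _ _
      (fun b => if b then (i, none) else (i, some (p.1, !p.2)))]
    · simp
    · intro b c h
      cases b <;> cases c <;> simp at h ⊢
    · rintro ⟨j, _ | ⟨q, b⟩⟩
      · simp [tri, tadj]
      · obtain ⟨p, c⟩ := p
        simp only [tri, tadj]
        cases b <;> cases c <;> simp
  let k₀ : Fin t := ⟨0, by omega⟩
  refine criterion_fin (by simp [ZMod.card]; left; ring) (tri m t hm)
    (fun v => if v.2 = none then 1 else -1) ?_ ?_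
    (fun v => v.2 = none) ?_ ?_ (0, none) (0, some (k₀, true)) rfl (by simp)
  · intro v; split_ifs <;> norm_num
  · intro x
    constructor
    · intro h
      have hS : ∀ i p, x (i, some p) = - x (i, none) := by
        intro i p
        have := h (i, some (p.1, !p.2))
        rw [hsS] at this
        simp only [Bool.not_not, Prod.mk.eta] at this
        linarith
      have hN : ∀ i, ∑ k : Fin t × Bool, x (i + stp m k, none) =
          ∑ k : Fin t × Bool, x (i, none) := by
        intro i
        have := h (i, none)
        rw [hsN] at this
        simp only [hS, Finset.sum_neg_distrib] at this
        linarith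
      obtain ⟨M, hM⟩ := Finite.exists_max (fun i => x (i, none))
      have hc : ∀ j, x (j, none) = x (M, none) := by
        apply all_of_step 1 isUnit_one (fun j => x (j, none) = x (M, none)) M rfl
        intro j hj
        have := (Finset.sum_eq_sum_iff_of_le (s := Finset.univ)
          (f := fun k : Fin t × Bool => x (j + stp m k, none)) (g := fun k => x (j, none))
          (fun k _ => by rw [hj]; exact hM _)).1 (hN j) (k₀, true) (Finset.mem_univ _)
        rw [← hj, ← this]
        simp [stp, k₀]
      refine ⟨x (M, none), ?_⟩
      ext ⟨i, _ | p⟩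
      · simp [hc i]
      · simp [hS, hc i]
    · rintro ⟨c, rfl⟩ ⟨i, _ | p⟩
      · rw [hsN]; simp
      · rw [hsS]; simp
  · have hQ : ∀ v : ZMod m × Option (Fin t × Bool), v.2 = none ↔ ∃ a b c,
        a ≠ b ∧ a ≠ c ∧ b ≠ c ∧ (tri m t hm).Adj v a ∧ (tri m t hm).Adj v b ∧
          (tri m t hm).Adj v c := by
      rintro ⟨i, _ | ⟨p, s⟩⟩
      · simp only [true_iff]
        exact ⟨(i + stp m (k₀, true), none), (i, some (k₀, true)), (i, some (k₀, false)),
          by simp, by simp, by simp, ⟨_, rfl⟩, rfl, rfl⟩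
      · simp only [reduceCtorEq, false_iff]
        have hu : ∀ u, (tri m t hm).Adj (i, some (p, s)) u →
            u = (i, none) ∨ u = (i, some (p, !s)) := by
          rintro ⟨j, _ | ⟨q, r⟩⟩ h
          · left; rw [show i = j from h]
          · right
            obtain ⟨h1, h2, h3⟩ := h
            simp only at h1 h2 h3
            subst h1 h2
            cases s <;> cases r <;> simp_all
        rintro ⟨a, b, c, h1, h2, h3, h4, h5, h6⟩
        rcases hu a h4 with rfl | rfl <;> rcases hu b h5 with rfl | rfl <;>
          rcases hu c h6 with rfl | rfl <;> simp at h1 h2 h3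
    intro α v hv
    rw [hQ] at hv ⊢
    obtain ⟨a, b, c, h1, h2, h3, h4, h5, h6⟩ := hv
    exact ⟨α a, α b, α c, α.injective.ne h1, α.injective.ne h2, α.injective.ne h3,
      α.map_adj_iff.2 h4, α.map_adj_iff.2 h5, α.map_adj_iff.2 h6⟩
  · have aut : ∀ (s : ZMod m) (σ : Equiv.Perm (Fin t)) (τ : Equiv.Perm Bool),
        ∃ α : tri m t hm ≃g tri m t hm, (∀ i, α (i, none) = (i + s, none)) ∧
          ∀ i p, α (i, some p) = (i + s, some (σ p.1, τ p.2)) := by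
      intro s σ τ
      refine ⟨⟨(Equiv.addRight s).prodCongr (σ.prodCongr τ).optionCongr, ?_⟩,
        fun i => rfl, fun i p => rfl⟩
      rintro ⟨i, _ | p⟩ ⟨j, _ | q⟩
      · change (∃ k, i + s + stp m k = j + s) ↔ ∃ k, i + stp m k = j
        apply exists_congr
        intro k
        rw [add_right_comm, add_left_inj]
      · exact add_left_inj s
      · exact add_left_inj s
      · change (i + s = j + s ∧ σ p.1 = σ q.1 ∧ τ p.2 ≠ τ q.2) ↔ (i = j ∧ p.1 = q.1 ∧ p.2 ≠ q.2)
        simp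
    rintro ⟨i, _ | p⟩ ⟨j, _ | q⟩ h
    · obtain ⟨α, h1, -⟩ := aut (j - i) 1 1
      exact ⟨α, by rw [h1]; simp⟩
    · simp at h
    · simp at h
    · obtain ⟨α, -, h1⟩ := aut (j - i) (Equiv.swap p.1 q.1) (Equiv.swap p.2 q.2)
      exact ⟨α, by rw [h1]; simp⟩

end Odd

/-- For every composite `n ≥ 9` there is a nut graph of order
`n` with exactly two vertex orbits. -/
theorem exists_nut_two_vertexOrbits (n : ℕ) (hn : 9 ≤ n) (hnp : ¬ n.Prime) :
    ∃ G : SimpleGraph (Fin n), IsNutGraph G ∧ numVertexOrbits G = 2 := by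
  by_cases h3 : 3 ∣ n
  · obtain ⟨m, rfl⟩ := h3
    rw [mul_comm]
    exact odd_case (m := m) (t := 1) le_rfl (by omega)
  by_cases h2 : 2 ∣ n
  · obtain ⟨m, rfl⟩ := h2
    rw [mul_comm]
    exact even_case (by omega) (by omega)
  · have hp : n.minFac.Prime := Nat.minFac_prime (by omega)
    have hsq : n.minFac ^ 2 ≤ n := Nat.minFac_sq_le_self (by omega) hnp
    obtain ⟨m, hm⟩ := Nat.minFac_dvd n
    have hodd : n.minFac % 2 = 1 := by
      rcases hp.eq_two_or_odd with h | h
      · exact absurd (h ▸ Nat.minFac_dvd n) h2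
      · exact h
    have hge := hp.two_le
    obtain ⟨t, ht⟩ : ∃ t, n.minFac = 2 * t + 1 := ⟨n.minFac / 2, by omega⟩
    rw [ht] at hm hsq hge
    have hle : 2 * t + 1 ≤ m := by
      by_contra hlt
      push Not at hlt
      nlinarith
    rw [hm, mul_comm]
    exact odd_case (by omega) hle

end NutPaper
end

section
/- Let r ≥ 2 be an even integer and let k ≥ r + 1. Then there exist infinitely many (pairwise non-isomorphic) nut graphs G with exactly r vertex orbits and exactly k edge orbits, i.e., o_v(G) = r and o_e(G) = k. -/
namespace NutPaper

open Matrix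

variable {V : Type*}

section General

variable {V : Type*}

theorem numVertexOrbits_eq {ι : Type*} [Fintype ι] (G : SimpleGraph V) (rep : ι → V)
    (cover : ∀ v, ∃ i, ∃ α : G ≃g G, α (rep i) = v)
    (inj : ∀ i j, ∀ α : G ≃g G, α (rep i) = rep j → i = j) :
    numVertexOrbits G = Fintype.card ι := by
  have h1 : vertexOrbits G = Set.range (fun i => vertexOrbit G (rep i)) := by
    ext s
    constructor
    · rintro ⟨v, rfl⟩
      obtain ⟨i, α, rfl⟩ := cover v
      refine ⟨i, ?_⟩
      ext u
      constructor
      · rintro ⟨β, rfl⟩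
        exact ⟨α.symm.trans β, by simp⟩
      · rintro ⟨β, rfl⟩
        exact ⟨α.trans β, by simp⟩
    · rintro ⟨i, rfl⟩
      exact ⟨rep i, rfl⟩
  have h2 : Function.Injective (fun i => vertexOrbit G (rep i)) := by
    intro i j hij
    have : rep j ∈ vertexOrbit G (rep i) := by
      have h : vertexOrbit G (rep i) = vertexOrbit G (rep j) := hij
      rw [h]
      exact ⟨RelIso.refl _, rfl⟩
    obtain ⟨α, hα⟩ := this
    exact inj i j α hα
  unfold numVertexOrbits
  rw [h1, ← Nat.card_eq_fintype_card]
  exact (Nat.card_congr (Equiv.ofInjective _ h2)).symm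

theorem numEdgeOrbits_eq {ι : Type*} [Fintype ι] (G : SimpleGraph V) (rep : ι → Sym2 V)
    (hmem : ∀ i, rep i ∈ G.edgeSet)
    (cover : ∀ e ∈ G.edgeSet, ∃ i, ∃ α : G ≃g G, Sym2.map (⇑α) (rep i) = e)
    (inj : ∀ i j, ∀ α : G ≃g G, Sym2.map (⇑α) (rep i) = rep j → i = j) :
    numEdgeOrbits G = Fintype.card ι := by
  have h1 : edgeOrbits G = Set.range (fun i => edgeOrbit G (rep i)) := by
    ext s
    constructor
    · rintro ⟨e, he, rfl⟩
      obtain ⟨i, α, rfl⟩ := cover e he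
      refine ⟨i, ?_⟩
      ext u
      constructor
      · rintro ⟨β, rfl⟩
        refine ⟨α.symm.trans β, ?_⟩
        rw [Sym2.map_map]
        congr 1
        ext v
        simp
      · rintro ⟨β, rfl⟩
        refine ⟨α.trans β, ?_⟩
        rw [Sym2.map_map]
        congr 1
    · rintro ⟨i, rfl⟩
      exact ⟨rep i, hmem i, rfl⟩
  have h2 : Function.Injective (fun i => edgeOrbit G (rep i)) := by
    intro i j hij
    have : rep j ∈ edgeOrbit G (rep i) := by
      have h : edgeOrbit G (rep i) = edgeOrbit G (rep j) := hij
      rw [h]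
      refine ⟨RelIso.refl _, ?_⟩
      exact congrFun Sym2.map_id (rep j)
    obtain ⟨α, hα⟩ := this
    exact inj i j α hα
  unfold numEdgeOrbits
  rw [h1, ← Nat.card_eq_fintype_card]
  exact (Nat.card_congr (Equiv.ofInjective _ h2)).symm

open scoped Classical in
theorem adjMat_mulVec [Fintype V] (G : SimpleGraph V) (x : V → ℝ) (v : V) :
    (adjMat G *ᵥ x) v = ∑ w, if G.Adj v w then x w else 0 := by
  simp [adjMat, Matrix.mulVec, dotProduct]

theorem isNut_of [Fintype V] [Nonempty V] (G : SimpleGraph V) (x₀ : V → ℝ)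
    (hfull : ∀ v, x₀ v ≠ 0) (hker : adjMat G *ᵥ x₀ = 0)
    (huniq : ∀ x, adjMat G *ᵥ x = 0 → ∃ c : ℝ, x = c • x₀) : IsNutGraph G := by
  constructor
  · rw [finrank_eq_one_iff']
    refine ⟨⟨x₀, by simpa using hker⟩, ?_, ?_⟩
    · intro h
      have h' : x₀ = 0 := congrArg Subtype.val h
      obtain ⟨v⟩ := ‹Nonempty V›
      exact hfull v (by rw [h']; rfl)
    · rintro ⟨x, hx⟩
      obtain ⟨c, hc⟩ := huniq x (by simpa using hx)
      exact ⟨c, Subtype.ext hc.symm⟩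
  · intro x hx hne v
    obtain ⟨c, rfl⟩ := huniq x hx
    have : c ≠ 0 := by
      rintro rfl
      exact hne (by simp)
    simpa using ⟨this, hfull v⟩

/-- Transport to `Fin N`. -/
theorem exists_fin [Fintype V] [Nonempty V] (G : SimpleGraph V) {ι κ : Type*}
    [Fintype ι] [Fintype κ] (x₀ : V → ℝ)
    (hfull : ∀ v, x₀ v ≠ 0) (hker : adjMat G *ᵥ x₀ = 0)
    (huniq : ∀ x, adjMat G *ᵥ x = 0 → ∃ c : ℝ, x = c • x₀)
    (rep : ι → V)
    (cover : ∀ v, ∃ i, ∃ α : G ≃g G, α (rep i) = v)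
    (inj : ∀ i j, ∀ α : G ≃g G, α (rep i) = rep j → i = j)
    (erep : κ → Sym2 V)
    (emem : ∀ i, erep i ∈ G.edgeSet)
    (ecover : ∀ e ∈ G.edgeSet, ∃ i, ∃ α : G ≃g G, Sym2.map (⇑α) (erep i) = e)
    (einj : ∀ i j, ∀ α : G ≃g G, Sym2.map (⇑α) (erep i) = erep j → i = j) :
    ∃ H : SimpleGraph (Fin (Fintype.card V)), IsNutGraph H ∧
      numVertexOrbits H = Fintype.card ι ∧ numEdgeOrbits H = Fintype.card κ := by
  classical
  let e := Fintype.equivFin V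
  let H : SimpleGraph (Fin (Fintype.card V)) := G.comap e.symm
  let φ : H ≃g G := ⟨e.symm, by intro a b; rfl⟩
  have : Nonempty (Fin (Fintype.card V)) := ⟨e (Classical.arbitrary V)⟩
  have key : ∀ (x : V → ℝ) (v : Fin (Fintype.card V)),
      (adjMat H *ᵥ (x ∘ φ)) v = (adjMat G *ᵥ x) (φ v) := by
    intro x v
    rw [adjMat_mulVec, adjMat_mulVec]
    rw [← Equiv.sum_comp φ.toEquiv]
    rfl
  refine ⟨H, isNut_of H (x₀ ∘ φ) (fun v => hfull _) ?_ ?_, ?_, ?_⟩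
  · ext v
    rw [key, hker]; rfl
  · intro x hx
    obtain ⟨c, hc⟩ := huniq (x ∘ φ.symm) (by
      ext v
      have := key (x ∘ φ.symm) (φ.symm v)
      rw [RelIso.apply_symm_apply] at this
      rw [← this]
      have h2 : (x ∘ φ.symm) ∘ φ = x := by ext; simp
      rw [h2, hx]; rfl)
    refine ⟨c, ?_⟩
    ext v
    have := congrFun hc (φ v)
    simpa using this
  · apply numVertexOrbits_eq H (fun i => φ.symm (rep i))
    · intro v
      obtain ⟨i, α, h⟩ := cover (φ v)
      exact ⟨i, (φ.trans α).trans φ.symm, by simp [h]⟩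
    · intro i j α h
      refine inj i j ((φ.symm.trans α).trans φ) ?_
      simp [h]
  · apply numEdgeOrbits_eq H (fun i => Sym2.map φ.symm (erep i))
    · intro i
      have := emem i
      revert this
      induction erep i with
      | _ a b =>
        intro this
        exact φ.symm.map_adj_iff.2 this
    · intro f hf
      obtain ⟨i, α, h⟩ := ecover (Sym2.map φ f) (by
        revert hf
        induction f with
        | _ a b => intro hf; exact φ.map_adj_iff.2 hf)
      refine ⟨i, (φ.trans α).trans φ.symm, ?_⟩
      have h2 := congrArg (Sym2.map φ.symm) h
      rw [Sym2.map_map, Sym2.map_map] at h2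
      rw [Sym2.map_map]
      convert h2 using 2
      · ext; simp
      · have : (φ.symm ∘ φ : _ → _) = id := by ext; simp
        rw [this]; simp
    · intro i j α h
      refine einj i j ((φ.symm.trans α).trans φ) ?_
      have h2 := congrArg (Sym2.map φ) h
      rw [Sym2.map_map, Sym2.map_map, Sym2.map_map] at h2
      have h3 : (φ ∘ φ.symm : _ → _) = id := by ext; simp
      rw [h3, Sym2.map_id] at h2
      exact h2

end General

section Construction

variable (n t j : ℕ)

/-- Connection set of the `t`-th power of the `n`-cycle. -/
noncomputable def conn : Finset (ZMod n) := ((Finset.Icc (-(t : ℤ)) t).erase 0).image (fun a : ℤ => (a : ZMod n))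

theorem mem_conn {z : ZMod n} :
    z ∈ conn n t ↔ ∃ a : ℤ, a ≠ 0 ∧ -(t : ℤ) ≤ a ∧ a ≤ t ∧ (a : ZMod n) = z := by
  simp [conn, and_assoc]

theorem neg_mem_conn {z : ZMod n} (h : z ∈ conn n t) : -z ∈ conn n t := by
  rw [mem_conn] at h ⊢
  obtain ⟨a, h0, h1, h2, rfl⟩ := h
  exact ⟨-a, by omega, by omega, by omega, by simp⟩

theorem cast_inj_of {a b : ℤ} (h : (a : ZMod n) = b) (h1 : a - b < n) (h2 : b - a < n) : a = b := by
  rw [ZMod.intCast_eq_intCast_iff_dvd_sub] at h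
  have := Int.eq_zero_of_abs_lt_dvd h (by rw [abs_lt]; constructor <;> omega)
  omega

theorem zero_notMem_conn (hn : 3 * t < n) : (0 : ZMod n) ∉ conn n t := by
  rw [mem_conn]
  rintro ⟨a, h0, h1, h2, h⟩
  exact h0 (cast_inj_of n (b := 0) (by simpa using h) (by omega) (by omega))

theorem card_conn (hn : 3 * t < n) : (conn n t).card = 2 * t := by
  rw [conn, Finset.card_image_of_injOn]
  · rw [Finset.card_erase_of_mem (by simp)]
    simp; omega
  · intro a ha b hb h
    simp at ha hb
    exact cast_inj_of n h (by omega) (by omega)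

/-- number of common neighbours at distance `s`. -/
theorem card_common (hn : 3 * t < n) (s : ℕ) (h1 : 1 ≤ s) (h2 : s ≤ t) :
    {z : ZMod n | z ∈ conn n t ∧ z - s ∈ conn n t}.ncard = 2 * t - 1 - s := by
  have : {z : ZMod n | z ∈ conn n t ∧ z - s ∈ conn n t} =
      (((((Finset.Icc ((s : ℤ) - t) t).erase 0).erase s).image
        (fun a : ℤ => (a : ZMod n)) : Finset (ZMod n)) : Set (ZMod n)) := by
    ext z
    simp only [Set.mem_ofPred_eq, mem_conn, Finset.coe_image, Set.mem_image, Finset.mem_coe,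
      Finset.mem_erase, Finset.mem_Icc]
    constructor
    · rintro ⟨⟨a, a0, a1, a2, rfl⟩, ⟨b, b0, b1, b2, hb⟩⟩
      have : b = a - s := cast_inj_of n (by rw [hb]; push_cast; rfl) (by omega) (by omega)
      exact ⟨a, ⟨by omega, by omega, by omega, by omega⟩, rfl⟩
    · rintro ⟨a, ⟨h3, h4, h5, h6⟩, rfl⟩
      exact ⟨⟨a, by omega, by omega, by omega, rfl⟩,
        ⟨a - s, by omega, by omega, by omega, by push_cast; rfl⟩⟩
  rw [this, Set.ncard_coe_finset, Finset.card_image_of_injOn]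
  · rw [Finset.card_erase_of_mem, Finset.card_erase_of_mem]
    · simp; omega
    · simp; omega
    · simp; omega
  · intro a ha b hb h
    simp at ha hb
    exact cast_inj_of n h (by omega) (by omega)

variable (C : Type) [AddCommGroup C] (τ : C)

/-- Vertices: roots, and gadget vertices. -/
abbrev VV := ZMod n ⊕ (ZMod n × C × Fin (2 * j + 1))

variable {n j C} in
/-- neighbour closer to the root -/
def dn (p : ZMod n × C × Fin (2 * j + 1)) : VV n j C :=
  if p.2.2.val = 0 then Sum.inl p.1
  else Sum.inr (p.1, p.2.1, ⟨p.2.2.val - 1, by omega⟩)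

variable {n j C} in
/-- neighbour further away from the root -/
def up (p : ZMod n × C × Fin (2 * j + 1)) : VV n j C :=
  if h : p.2.2.val + 1 < 2 * j + 1 then Sum.inr (p.1, p.2.1, ⟨p.2.2.val + 1, h⟩)
  else Sum.inr (p.1, p.2.1 + τ, p.2.2)

/-- Adjacency. -/
def adjRel : VV n j C → VV n j C → Prop
  | Sum.inl z, Sum.inl z' => z' - z ∈ conn n t
  | Sum.inl z, Sum.inr q => z = q.1 ∧ q.2.2.val = 0
  | Sum.inr p, Sum.inl z => z = p.1 ∧ p.2.2.val = 0
  | Sum.inr p, Sum.inr q => p.1 = q.1 ∧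
      ((p.2.1 = q.2.1 ∧ (p.2.2.val + 1 = q.2.2.val ∨ q.2.2.val + 1 = p.2.2.val)) ∨
        (q.2.1 = p.2.1 + τ ∧ p.2.2 = q.2.2 ∧ p.2.2.val = 2 * j))

variable {τ} in
/-- The graph. -/
def GG (hn : 3 * t < n) (hτ : τ ≠ 0) (hττ : τ + τ = 0) : SimpleGraph (VV n j C) where
  Adj := adjRel n t j C τ
  symm := ⟨by
    rintro (z | ⟨z, c, d⟩) (z' | ⟨z', c', d'⟩) h
    · have := neg_mem_conn n t h
      simpa [adjRel] using this
    · exact h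
    · exact h
    · obtain ⟨h1, h2 | ⟨h2, h3, h4⟩⟩ := h
      · exact ⟨h1.symm, Or.inl ⟨h2.1.symm, h2.2.symm⟩⟩
      · simp only at h1 h2 h3 h4
        refine ⟨h1.symm, Or.inr ⟨?_, h3.symm, ?_⟩⟩
        · simp [h2, add_assoc, hττ]
        · simp [← h3, h4]⟩
  loopless := ⟨by
    rintro (z | ⟨z, c, d⟩) h
    · exact zero_notMem_conn n t hn (by simpa [adjRel] using h)
    · obtain ⟨h1, h2 | ⟨h2, h3, h4⟩⟩ := h
      · simp at h2
      · simp at h2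
        exact hτ h2⟩

variable {n t j C τ}
variable (hn : 3 * t < n) (hτ : τ ≠ 0) (hττ : τ + τ = 0)

theorem adj_inr (p : ZMod n × C × Fin (2 * j + 1)) (v : VV n j C) :
    (GG n t j C hn hτ hττ).Adj (Sum.inr p) v ↔ v = dn p ∨ v = up τ p := by
  obtain ⟨z, c, d⟩ := p
  rcases v with z' | ⟨z', c', d'⟩
  · simp only [GG, adjRel, dn, up]
    split_ifs <;> simp_all
  · simp only [GG, adjRel, dn, up]
    have := d.2
    have := d'.2
    by_cases h : d.val = 0 <;> by_cases h' : d.val + 1 < 2 * j + 1 <;>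
      simp only [h, h', if_true, if_false, dite_true, dite_false, Sum.inr.injEq, Prod.mk.injEq,
        Fin.ext_iff, reduceCtorEq, false_or] <;> grind

theorem dn_ne_up (p : ZMod n × C × Fin (2 * j + 1)) (hτ : τ ≠ 0) : dn p ≠ up τ p := by
  obtain ⟨z, c, d⟩ := p
  simp only [dn, up]
  split_ifs <;> simp [Fin.ext_iff, hτ]

/-- depth -/
def depth : VV n j C → ℕ
  | Sum.inl _ => 0
  | Sum.inr p => p.2.2.val + 1

theorem depth_dn (p : ZMod n × C × Fin (2 * j + 1)) : depth (dn p) = p.2.2.val := by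
  unfold dn
  split_ifs with h
  · simp [depth, h]
  · simp [depth]; omega

theorem depth_adj {u v : VV n j C} (h : (GG n t j C hn hτ hττ).Adj u v) :
    depth v ≤ depth u + 1 := by
  rcases u with z | ⟨z, c, d⟩ <;> rcases v with z' | ⟨z', c', d'⟩ <;>
    simp only [GG, adjRel, depth] at h ⊢
  · omega
  · omega
  · omega
  · grind

theorem one_mem_conn (ht : 1 ≤ t) : (1 : ZMod n) ∈ conn n t := by
  rw [mem_conn]
  exact ⟨1, by omega, by omega, by omega, by simp⟩

theorem root_iff (ht : 1 ≤ t) (v : VV n j C) : depth v = 0 ↔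
    ∃ a b c, a ≠ b ∧ b ≠ c ∧ a ≠ c ∧ (GG n t j C hn hτ hττ).Adj v a ∧
      (GG n t j C hn hτ hττ).Adj v b ∧ (GG n t j C hn hτ hττ).Adj v c := by
  rcases v with z | p
  · simp only [depth, true_iff]
    refine ⟨Sum.inl (z + 1), Sum.inl (z - 1), Sum.inr (z, 0, 0), ?_, by simp, by simp, ?_, ?_, ?_⟩
    · intro h
      have h1 : z + 1 = z - 1 := by simpa using h
      have h2 : ((2 : ℤ) : ZMod n) = ((0 : ℤ) : ZMod n) := by
        push_cast
        linear_combination h1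
      have := cast_inj_of n h2 (by omega) (by omega)
      omega
    · simpa [GG, adjRel] using one_mem_conn ht
    · simpa [GG, adjRel] using neg_mem_conn n t (one_mem_conn ht)
    · simp [GG, adjRel]
  · constructor
    · intro h
      simp [depth] at h
    · rintro ⟨a, b, c, hab, hbc, hac, ha, hb, hc⟩
      rw [adj_inr] at ha hb hc
      grind

theorem depth_le (ht : 1 ≤ t) (α : GG n t j C hn hτ hττ ≃g GG n t j C hn hτ hττ) (i : ℕ) :
    ∀ v, depth v = i → depth (α v) ≤ i := by
  induction i with
  | zero =>
    intro v hv
    rw [root_iff hn hτ hττ ht] at hv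
    obtain ⟨a, b, c, hab, hbc, hac, ha, hb, hc⟩ := hv
    refine le_of_eq ((root_iff hn hτ hττ ht _).2 ⟨α a, α b, α c, ?_⟩)
    exact ⟨α.injective.ne hab, α.injective.ne hbc, α.injective.ne hac, α.map_adj_iff.2 ha,
      α.map_adj_iff.2 hb, α.map_adj_iff.2 hc⟩
  | succ i ih =>
    intro v hv
    rcases v with z | p
    · simp [depth] at hv
    · have h1 : (GG n t j C hn hτ hττ).Adj (Sum.inr p) (dn p) := by
        rw [adj_inr]; exact Or.inl rfl
      have h2 := ih (dn p) (by rw [depth_dn]; simpa [depth] using hv)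
      have h3 := depth_adj hn hτ hττ (α.map_adj_iff.2 h1.symm)
      omega

theorem depth_aut (ht : 1 ≤ t) (α : GG n t j C hn hτ hττ ≃g GG n t j C hn hτ hττ) (v : VV n j C) :
    depth (α v) = depth v := by
  apply le_antisymm
  · exact depth_le hn hτ hττ ht α _ v rfl
  · have := depth_le hn hτ hττ ht α.symm _ (α v) rfl
    simpa using this

/-- translation automorphisms -/
def trans (a : ZMod n) (b : C) : GG n t j C hn hτ hττ ≃g GG n t j C hn hτ hττ where
  toEquiv := Equiv.sumCongr (Equiv.addLeft a)
    (Equiv.prodCongr (Equiv.addLeft a) (Equiv.prodCongr (Equiv.addLeft b) (Equiv.refl _)))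
  map_rel_iff' := by
    rintro (z | ⟨z, c, d⟩) (z' | ⟨z', c', d'⟩) <;> simp [GG, adjRel, add_assoc]

@[simp] theorem trans_inl (a : ZMod n) (b : C) (z : ZMod n) :
    trans (j := j) hn hτ hττ a b (Sum.inl z) = Sum.inl (a + z) := rfl

@[simp] theorem trans_inr (a : ZMod n) (b : C) (z : ZMod n) (c : C) (d : Fin (2 * j + 1)) :
    trans hn hτ hττ a b (Sum.inr (z, c, d)) = Sum.inr (a + z, b + c, d) := rfl

theorem trans_dn (a : ZMod n) (b : C) (z : ZMod n) (c : C) (d : Fin (2 * j + 1)) :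
    trans hn hτ hττ a b (dn (z, c, d)) = dn (a + z, b + c, d) := by
  unfold dn
  split_ifs <;> simp_all

/-- vertex representatives -/
def vrep : Option (Fin (2 * j + 1)) → VV n j C
  | none => Sum.inl 0
  | some d => Sum.inr (0, 0, d)

theorem vcover (v : VV n j C) : ∃ i, ∃ α : GG n t j C hn hτ hττ ≃g GG n t j C hn hτ hττ,
    α (vrep i) = v := by
  rcases v with z | ⟨z, c, d⟩
  · exact ⟨none, trans hn hτ hττ z 0, by simp [vrep]⟩
  · exact ⟨some d, trans hn hτ hττ z c, by simp [vrep]⟩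

theorem vinj (ht : 1 ≤ t) (i i' : Option (Fin (2 * j + 1)))
    (α : GG n t j C hn hτ hττ ≃g GG n t j C hn hτ hττ) (h : α (vrep i) = vrep i') : i = i' := by
  have h1 := depth_aut hn hτ hττ ht α (vrep i)
  rw [h] at h1
  rcases i with _ | d <;> rcases i' with _ | d' <;> simp [vrep, depth] at h1 ⊢
  omega

variable (t τ) in
/-- edge representatives -/
def erep : Fin t ⊕ Option (Fin (2 * j + 1)) → Sym2 (VV n j C)
  | Sum.inl s => s(Sum.inl 0, Sum.inl ((s.val + 1 : ℕ) : ZMod n))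
  | Sum.inr (some d) => s(Sum.inr (0, 0, d), dn (0, 0, d))
  | Sum.inr none => s(Sum.inr (0, 0, Fin.last _), Sum.inr (0, τ, Fin.last _))

theorem emem (i : Fin t ⊕ Option (Fin (2 * j + 1))) :
    erep t τ i ∈ (GG n t j C hn hτ hττ).edgeSet := by
  rcases i with s | _ | d
  · simp only [erep, SimpleGraph.mem_edgeSet, GG, adjRel, mem_conn]
    exact ⟨s.val + 1, by omega, by omega, by omega, by push_cast; ring⟩
  · simp [erep, GG, adjRel]
  · simp only [erep, SimpleGraph.mem_edgeSet, adj_inr, true_or]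

theorem ecover (e : Sym2 (VV n j C)) (he : e ∈ (GG n t j C hn hτ hττ).edgeSet) :
    ∃ i, ∃ α : GG n t j C hn hτ hττ ≃g GG n t j C hn hτ hττ,
      Sym2.map (⇑α) (erep t τ i) = e := by
  induction e with
  | _ u v =>
  rw [SimpleGraph.mem_edgeSet] at he
  have down : ∀ p : ZMod n × C × Fin (2 * j + 1), ∃ i,
      ∃ α : GG n t j C hn hτ hττ ≃g GG n t j C hn hτ hττ,
      Sym2.map (⇑α) (erep t τ i) = s(Sum.inr p, dn p) := by
    rintro ⟨z, c, d⟩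
    exact ⟨Sum.inr (some d), trans hn hτ hττ z c, by simp [erep, trans_dn]⟩
  rcases u with z | ⟨z, c, d⟩ <;> rcases v with z' | ⟨z', c', d'⟩
  · simp only [GG, adjRel, mem_conn] at he
    obtain ⟨a, a0, a1, a2, ha⟩ := he
    rcases lt_or_gt_of_ne a0 with h | h
    · refine ⟨Sum.inl ⟨(-a).toNat - 1, by omega⟩, trans hn hτ hττ z' 0, ?_⟩
      have h1 : (((-a).toNat - 1 + 1 : ℕ) : ℤ) = -a := by omega
      have h2 := congrArg (Int.cast : ℤ → ZMod n) h1
      rw [Int.cast_natCast] at h2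
      simp only [erep, Sym2.map_mk, trans_inl, h2]
      rw [Sym2.eq_swap]
      congr 3
      · push_cast; rw [ha]; ring
      · ring
    · refine ⟨Sum.inl ⟨a.toNat - 1, by omega⟩, trans hn hτ hττ z 0, ?_⟩
      have h1 : ((a.toNat - 1 + 1 : ℕ) : ℤ) = a := by omega
      have h2 := congrArg (Int.cast : ℤ → ZMod n) h1
      rw [Int.cast_natCast] at h2
      simp only [erep, Sym2.map_mk, trans_inl, h2]
      congr 3
      · ring
      · rw [ha]; ring
  · obtain ⟨i, α, h⟩ := down (z', c', d')
    refine ⟨i, α, h.trans ?_⟩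
    rw [Sym2.eq_swap]
    obtain ⟨h1, h2⟩ := he
    simp at h1 h2
    simp [dn, h1, h2]
  · obtain ⟨i, α, h⟩ := down (z, c, d)
    refine ⟨i, α, h.trans ?_⟩
    obtain ⟨h1, h2⟩ := he
    simp at h1 h2
    simp [dn, h1, h2]
  · obtain ⟨h1, ⟨h2, h3 | h3⟩ | ⟨h2, h3, h4⟩⟩ := he
    · obtain ⟨i, α, h⟩ := down (z', c', d')
      refine ⟨i, α, h.trans ?_⟩
      rw [Sym2.eq_swap]
      simp only at h1 h2 h3
      have : d'.val ≠ 0 := by omega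
      have h5 : d.val = d'.val - 1 := by omega
      simp [dn, h1, h2, this, Fin.ext_iff, h5]
    · obtain ⟨i, α, h⟩ := down (z, c, d)
      refine ⟨i, α, h.trans ?_⟩
      simp only at h1 h2 h3
      have : d.val ≠ 0 := by omega
      have h5 : d'.val = d.val - 1 := by omega
      simp [dn, h1, h2, this, Fin.ext_iff, h5]
    · simp only at h1 h2 h3 h4
      subst h1 h2 h3
      have : d = Fin.last _ := Fin.ext h4
      subst this
      exact ⟨Sum.inr none, trans hn hτ hττ z c, by simp [erep]⟩

/-- sum of depths -/
def dsum : Sym2 (VV n j C) → ℕ :=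
  Sym2.lift ⟨fun u v => depth u + depth v, fun _ _ => Nat.add_comm _ _⟩

theorem dsum_aut (ht : 1 ≤ t) (α : GG n t j C hn hτ hττ ≃g GG n t j C hn hτ hττ) (e : Sym2 (VV n j C)) :
    dsum (Sym2.map α e) = dsum e := by
  induction e with
  | _ u v => simp [dsum, depth_aut hn hτ hττ ht α]

theorem common_root (s : ℕ) (h1 : 1 ≤ s) (h2 : s ≤ t) :
    {w | (GG n t j C hn hτ hττ).Adj (Sum.inl 0) w ∧
      (GG n t j C hn hτ hττ).Adj (Sum.inl (s : ZMod n)) w}.ncard = 2 * t - 1 - s := by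
  rw [← card_common n t hn s h1 h2, ← Set.ncard_image_of_injective _
    (Sum.inl_injective : Function.Injective (Sum.inl : ZMod n → VV n j C))]
  congr 1
  ext w
  rcases w with z | ⟨z, c, d⟩
  · simp [GG, adjRel]
  · simp only [GG, adjRel, Set.mem_ofPred_eq, Set.mem_image, reduceCtorEq, and_false, exists_false,
      iff_false]
    rintro ⟨⟨h3, -⟩, ⟨h4, -⟩⟩
    have h5 : ((s : ℤ) : ZMod n) = ((0 : ℤ) : ZMod n) := by
      push_cast
      rw [h3, h4]
    have := cast_inj_of n h5 (by omega) (by omega)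
    omega

theorem common_aut {W : Type*} (G : SimpleGraph W) (α : G ≃g G) (u v : W) :
    {w | G.Adj (α u) w ∧ G.Adj (α v) w}.ncard = {w | G.Adj u w ∧ G.Adj v w}.ncard := by
  rw [← Set.ncard_image_of_injective {w | G.Adj u w ∧ G.Adj v w} α.injective]
  congr 1
  ext w
  constructor
  · rintro ⟨h1, h2⟩
    refine ⟨α.symm w, ⟨?_, ?_⟩, by simp⟩
    · rw [← α.map_adj_iff]; simpa using h1
    · rw [← α.map_adj_iff]; simpa using h2
  · rintro ⟨w, ⟨h1, h2⟩, rfl⟩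
    exact ⟨α.map_adj_iff.2 h1, α.map_adj_iff.2 h2⟩

theorem einj (ht : 1 ≤ t) (i i' : Fin t ⊕ Option (Fin (2 * j + 1)))
    (α : GG n t j C hn hτ hττ ≃g GG n t j C hn hτ hττ)
    (h : Sym2.map (⇑α) (erep t τ i) = erep t τ i') : i = i' := by
  have h1 := dsum_aut hn hτ hττ ht α (erep t τ i)
  rw [h] at h1
  rcases i with s | _ | d <;> rcases i' with s' | _ | d' <;>
    simp [erep, dsum, depth_dn] at h1 ⊢ <;> simp [depth] at h1
  · have c1 := common_root (j := j) (C := C) hn hτ hττ (s.val + 1) (by omega) (by omega)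
    have c2 := common_root (j := j) (C := C) hn hτ hττ (s'.val + 1) (by omega) (by omega)
    have c3 := common_aut _ α (Sum.inl 0) (Sum.inl ((s.val + 1 : ℕ) : ZMod n))
    simp only [erep, Sym2.map_mk, Sym2.eq_iff] at h
    have c4 : 2 * t - 1 - (s'.val + 1) = 2 * t - 1 - (s.val + 1) := by
      rcases h with ⟨ha, hb⟩ | ⟨ha, hb⟩
      · rw [ha, hb] at c3
        rw [← c1, ← c2, c3]
      · rw [ha, hb] at c3
        rw [← c1, ← c2, ← c3]
        congr 1
        ext w
        exact and_comm
    apply Fin.ext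
    omega
  all_goals omega

variable [Fintype C] [NeZero n]

open scoped Classical in
theorem ker_inr (x : VV n j C → ℝ) (p : ZMod n × C × Fin (2 * j + 1)) :
    (adjMat (GG n t j C hn hτ hττ) *ᵥ x) (Sum.inr p) = x (dn p) + x (up τ p) := by
  rw [adjMat_mulVec, ← Finset.sum_filter]
  have : Finset.univ.filter (fun w => (GG n t j C hn hτ hττ).Adj (Sum.inr p) w)
      = {dn p, up τ p} := by
    ext w
    simp [adj_inr]
  rw [this, Finset.sum_pair (dn_ne_up p hτ)]

open scoped Classical in
theorem ker_inl (x : VV n j C → ℝ) (z : ZMod n) :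
    (adjMat (GG n t j C hn hτ hττ) *ᵥ x) (Sum.inl z) =
      ∑ s ∈ conn n t, x (Sum.inl (z + s)) + ∑ c, x (Sum.inr (z, c, 0)) := by
  rw [adjMat_mulVec, Fintype.sum_sum_type]
  congr 1
  · rw [← Equiv.sum_comp (Equiv.addLeft z)]
    simp [GG, adjRel]
  · rw [Fintype.sum_prod_type, Finset.sum_eq_single z]
    · rw [Fintype.sum_prod_type]
      refine Finset.sum_congr rfl fun c _ => ?_
      rw [Finset.sum_eq_single 0]
      · simp [GG, adjRel]
      · intro d _ hd
        simp [GG, adjRel, hd]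
      · simp
    · intro z' _ hz
      simp [GG, adjRel, hz.symm]
    · simp

/-- signs -/
def sg (d : ℕ) : ℝ := -(-1) ^ (d / 2)

theorem sg_add_two (d : ℕ) : sg (d + 2) = - sg d := by
  have : (d + 2) / 2 = d / 2 + 1 := by omega
  simp [sg, this, pow_succ]

theorem sg_ne (d : ℕ) : sg d ≠ 0 := by
  simp [sg]

/-- kernel vector -/
def x0 : VV n j C → ℝ
  | Sum.inl _ => 1
  | Sum.inr p => sg p.2.2.val

theorem x0_ne (v : VV n j C) : x0 v ≠ 0 := by
  rcases v with z | p
  · simp [x0]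
  · exact sg_ne _

theorem sg_zero : sg 0 = -1 := by simp [sg]
theorem sg_one : sg 1 = -1 := by simp [sg]

theorem sg_double (i : ℕ) : sg (2 * i) = sg (2 * i + 1) := by
  have : (2 * i + 1) / 2 = 2 * i / 2 := by omega
  simp [sg, this]

theorem x0_ker (hC : Fintype.card C = 2 * t) :
    adjMat (GG n t j C hn hτ hττ) *ᵥ x0 = 0 := by
  ext v
  rcases v with z | ⟨z, c, d⟩
  · rw [ker_inl]
    simp [x0, card_conn n t hn, hC, sg_zero]
  · rw [ker_inr]
    simp only [Pi.zero_apply, dn, up]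
    have hd := d.2
    by_cases h : d.val = 0
    · by_cases h' : d.val + 1 < 2 * j + 1
      · simp [h, x0, sg_one]
        have : 0 < j := by omega
        simp [this, sg_one]
      · simp [h, x0]
        have : ¬ 0 < j := by omega
        simp [this, h, sg_zero]
    · by_cases h' : d.val + 1 < 2 * j + 1
      · simp only [h, h', if_false, dite_true, x0]
        have := sg_add_two (d.val - 1)
        rw [show d.val - 1 + 2 = d.val + 1 by omega] at this
        rw [this]; ring
      · simp only [h, h', if_false, dite_false, x0]
        have h2 : d.val = 2 * (j - 1) + 2 := by omega
        have := sg_add_two (2 * (j - 1))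
        rw [h2, this, sg_double]
        simp

theorem gadget (x : VV n j C → ℝ) (hx : adjMat (GG n t j C hn hτ hττ) *ᵥ x = 0)
    (z : ZMod n) (c : C) (d : Fin (2 * j + 1)) :
    x (Sum.inr (z, c, d)) = sg d.val * x (Sum.inl z) := by
  have hp : ∀ p, x (dn p) + x (up τ p) = 0 := by
    intro p
    rw [← ker_inr hn hτ hττ, hx]; rfl
  -- odd positions
  have hodd : ∀ c i, ∀ h : 2 * i + 1 < 2 * j + 1,
      x (Sum.inr (z, c, ⟨2 * i + 1, h⟩)) = sg (2 * i + 1) * x (Sum.inl z) := by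
    intro c i
    induction i with
    | zero =>
      intro h
      have := hp (z, c, ⟨0, by omega⟩)
      have hj : 0 < j := by omega
      simp [dn, up, hj] at this
      simp [sg_one]
      linarith
    | succ i ih =>
      intro h
      have := hp (z, c, ⟨2 * i + 2, by omega⟩)
      have h3 : 2 * i + 2 + 1 < 2 * j + 1 := by omega
      simp only [dn, up, h3, dite_true] at this
      rw [if_neg (by omega)] at this
      have h4 := ih (by omega)
      have h5 : sg (2 * (i + 1) + 1) = - sg (2 * i + 1) := sg_add_two (2 * i + 1)
      rw [h5]
      simp only [Nat.add_sub_cancel, show 2 * i + 2 - 1 = 2 * i + 1 by omega] at this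
      rw [h4] at this
      have h6 : (⟨2 * (i + 1) + 1, h⟩ : Fin (2 * j + 1)) = ⟨2 * i + 2 + 1, h3⟩ := rfl
      rw [h6]
      linarith
  -- top
  have htop : ∀ c, x (Sum.inr (z, c, Fin.last _)) = sg (2 * j) * x (Sum.inl z) := by
    intro c
    have h0 := hp (z, c + τ, Fin.last _)
    simp only [dn, up, Fin.val_last, lt_irrefl, dite_false, add_assoc, hττ, add_zero] at h0
    by_cases hj : j = 0
    · subst hj
      simp [sg_zero] at h0 ⊢
      linarith
    · rw [if_neg (by omega)] at h0
      have h1 := hodd (c + τ) (j - 1) (by omega)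
      have h2 : (⟨2 * j - 1, by omega⟩ : Fin (2 * j + 1)) = ⟨2 * (j - 1) + 1, by omega⟩ :=
        Fin.ext (by simp; omega)
      rw [h2, h1] at h0
      have h3 : sg (2 * j) = - sg (2 * (j - 1) + 1) := by
        rw [← sg_double, ← sg_add_two]
        congr 1; omega
      rw [h3]
      linarith
  -- even positions, downward
  have heven : ∀ c i, ∀ _ : i ≤ j,
      x (Sum.inr (z, c, ⟨2 * (j - i), by omega⟩)) = sg (2 * (j - i)) * x (Sum.inl z) := by
    intro c i
    induction i with
    | zero =>
      intro _
      exact htop c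
    | succ i ih =>
      intro h
      have h4 := ih (by omega)
      obtain ⟨l, hl⟩ : ∃ l, j - (i + 1) = l := ⟨_, rfl⟩
      have hl' : j - i = l + 1 := by omega
      have hlj : l + 1 ≤ j := by omega
      simp only [hl'] at h4
      simp only [hl]
      have := hp (z, c, ⟨2 * l + 1, by omega⟩)
      have h3 : 2 * l + 1 + 1 < 2 * j + 1 := by omega
      simp only [dn, up, h3, dite_true] at this
      rw [if_neg (by omega)] at this
      simp only [Nat.add_sub_cancel] at this
      have h6 : (⟨2 * l + 1 + 1, h3⟩ : Fin (2 * j + 1)) = ⟨2 * (l + 1), by omega⟩ := rfl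
      rw [h6, h4] at this
      have h5 : sg (2 * (l + 1)) = - sg (2 * l) := sg_add_two (2 * l)
      rw [h5] at this
      linarith
  obtain ⟨d, hd⟩ := d
  rcases Nat.even_or_odd' d with ⟨i, rfl | rfl⟩
  · have := heven c (j - i) (by omega)
    have h2 : j - (j - i) = i := by omega
    simpa only [h2] using this
  · exact hodd c i hd

theorem huniq (ht : 1 ≤ t) (hC : Fintype.card C = 2 * t) (x : VV n j C → ℝ)
    (hx : adjMat (GG n t j C hn hτ hττ) *ᵥ x = 0) : ∃ a : ℝ, x = a • x0 := by
  have hg := gadget hn hτ hττ x hx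
  have hroot : ∀ z, ∑ s ∈ conn n t, x (Sum.inl (z + s)) = ∑ s ∈ conn n t, x (Sum.inl z) := by
    intro z
    have h := ker_inl hn hτ hττ x z
    rw [hx] at h
    simp only [hg, Pi.zero_apply] at h
    simp [hC, sg_zero] at h
    simp [card_conn n t hn]
    linarith
  obtain ⟨z₀, hz₀⟩ := Finite.exists_max (fun z : ZMod n => x (Sum.inl z))
  have hstep : ∀ i : ℕ, x (Sum.inl (z₀ + i)) = x (Sum.inl z₀) := by
    intro i
    induction i with
    | zero => simp
    | succ i ih =>
      have h1 := hroot (z₀ + i)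
      rw [Finset.sum_eq_sum_iff_of_le (fun s _ => by rw [ih]; exact hz₀ _)] at h1
      have h2 := h1 1 (one_mem_conn ht)
      rw [← ih, ← h2]
      push_cast
      rw [add_assoc]
  have hall : ∀ z, x (Sum.inl z) = x (Sum.inl z₀) := by
    intro z
    have := hstep (z - z₀).val
    rw [ZMod.natCast_zmod_val] at this
    rw [← this]
    congr 2
    ring
  refine ⟨x (Sum.inl z₀), ?_⟩
  ext v
  rcases v with z | ⟨z, c, d⟩
  · simp [x0, hall z]
  · simp [x0, hg, hall z, mul_comm]

end Construction

/-- For every even `r ≥ 2` and every `k ≥ r + 1` there are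
infinitely many (pairwise non-isomorphic) nut graphs with exactly `r` vertex
orbits and exactly `k` edge orbits: the set of orders of such graphs is
infinite. -/
theorem infinitely_many_nut_graphs_with_orbit_counts (r k : ℕ)
    (hr : Even r) (hr2 : 2 ≤ r) (hk : r + 1 ≤ k) :
    {n : ℕ | ∃ G : SimpleGraph (Fin n),
      IsNutGraph G ∧ numVertexOrbits G = r ∧ numEdgeOrbits G = k}.Infinite := by
  obtain ⟨j, rfl⟩ : ∃ j, r = 2 * j + 2 := by
    obtain ⟨a, rfl⟩ := hr
    exact ⟨a - 1, by omega⟩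
  obtain ⟨t, ht, rfl⟩ : ∃ t, 1 ≤ t ∧ k = t + (2 * j + 2) := ⟨k - (2 * j + 2), by omega, by omega⟩
  apply Set.infinite_of_forall_exists_gt
  intro a
  have hn : 3 * t < a + 3 * t + 1 := by omega
  have : NeZero t := ⟨by omega⟩
  have hτ : ((0, 1) : ZMod t × ZMod 2) ≠ 0 := by simp
  have hττ : ((0, 1) : ZMod t × ZMod 2) + (0, 1) = 0 := by
    simp only [Prod.mk_add_mk, add_zero]
    rfl
  have hC : Fintype.card (ZMod t × ZMod 2) = 2 * t := by
    simp [ZMod.card, mul_comm]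
  obtain ⟨H, h1, h2, h3⟩ := exists_fin
    (GG (a + 3 * t + 1) t j (ZMod t × ZMod 2) hn hτ hττ) x0 x0_ne
    (x0_ker hn hτ hττ hC) (huniq hn hτ hττ ht hC) vrep (vcover hn hτ hττ) (vinj hn hτ hττ ht)
    (erep t _) (emem hn hτ hττ) (ecover hn hτ hττ) (einj hn hτ hττ ht)
  refine ⟨_, ⟨H, h1, ?_, ?_⟩, ?_⟩
  · rw [h2]; simp
  · rw [h3]; simp
  · simp only [Fintype.card_sum, ZMod.card]
    omega

end NutPaper
end
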